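/- For all integers n ≥ 0 and 0 ≤ l ≤ n and all x ∈ ℝ³, the recurrence A_{n+1}^l(x) = ((n+1)/(2(n−l+1)(n+l+2)))·[(2n+3)·x·A_n^l(x) + (2l+1)·x̄·(A_n^l)^(x)] holds, where x and x̄ denote left multiplication by the reduced quaternion x and its conjugate, and g^ denotes the involution applied to g. -/

import Mathlib

open MeasureTheory Metric Finset

noncomputable section

/-- `ℝ³` with the Euclidean norm and Lebesgue measure. -/
abbrev R3 := EuclideanSpace ℝ (Fin 3)
/-- the real quaternions ℍ -/
abbrev QH := Quaternion ℝ

/-- the basis quaternion e₁ -/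
def e1 : QH := ⟨0,1,0,0⟩
/-- the basis quaternion e₂ -/
def e2 : QH := ⟨0,0,1,0⟩
/-- the basis quaternion e₃ -/
def e3 : QH := ⟨0,0,0,1⟩

/-- embed a point of ℝ³ as the reduced quaternion x₀ + x₁e₁ + x₂e₂ -/
def toQ (x : R3) : QH := ⟨x 0, x 1, x 2, 0⟩
/-- the conjugate reduced quaternion x₀ - x₁e₁ - x₂e₂ -/
def toQbar (x : R3) : QH := ⟨x 0, -(x 1), -(x 2), 0⟩
/-- ζ = x₁ - x₂e₃ -/
def zeta (x : R3) : QH := ⟨x 1, 0, 0, -(x 2)⟩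

/-- build a point of ℝ³ from coordinates -/
def mk3 (a b c : ℝ) : R3 := (WithLp.equiv 2 (Fin 3 → ℝ)).symm ![a, b, c]

/-- the conjugated point (x₀, -x₁, -x₂) -/
def barPt (x : R3) : R3 := mk3 (x 0) (-(x 1)) (-(x 2))

/-- partial derivative ∂f/∂xᵢ -/
def pd (i : Fin 3) (f : R3 → QH) (x : R3) : QH :=
  fderiv ℝ f x (EuclideanSpace.single i 1)

/-- the generalized Cauchy-Riemann operator ∂̄f = ∂f/∂x₀ + e₁∂f/∂x₁ + e₂∂f/∂x₂ -/
def CRbar (f : R3 → QH) (x : R3) : QH :=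
  pd 0 f x + e1 * pd 1 f x + e2 * pd 2 f x

/-- the adjoint generalized Cauchy-Riemann operator ∂f = ∂f/∂x₀ - e₁∂f/∂x₁ - e₂∂f/∂x₂ -/
def Dadj (f : R3 → QH) (x : R3) : QH :=
  pd 0 f x - e1 * pd 1 f x - e2 * pd 2 f x

/-- the hypercomplex derivative ∂₀ = (1/2)∂ -/
def D0 (f : R3 → QH) : R3 → QH := fun x =>
  (1/2 : ℝ) • (pd 0 f x - e1 * pd 1 f x - e2 * pd 2 f x)

/-- the operator ∂̄_ℂ f = (1/2)(∂f/∂x₁ + e₃∂f/∂x₂) -/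
def DbarC (f : R3 → QH) : R3 → QH := fun x =>
  (1/2 : ℝ) • (pd 1 f x + e3 * pd 2 f x)

/-- the involution f⁰ + f¹e₁ + f²e₂ + f³e₃ ↦ f⁰ - f¹e₁ - f²e₂ + f³e₃ -/
def invol (a : QH) : QH := ⟨a.re, -a.imI, -a.imJ, a.imK⟩

/-- the inner Appell polynomial A_n^l -/
def appell (n l : ℕ) (x : R3) : QH :=
  ((n.factorial * l.factorial : ℝ) /
      (2 ^ (2 * (n - l)) * (n + l + 1).factorial * (2 * l).factorial)) •
    ((∑ h ∈ Finset.range (n - l + 1),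
        (((2 * n - 2 * h + 1).factorial * (2 * l + 2 * h).factorial : ℝ) /
            (h.factorial * (n - l - h).factorial * (n - h).factorial * (l + h).factorial)) •
          (toQbar x ^ h * toQ x ^ (n - l - h))) * zeta x ^ l)

/-- the Kelvin transform K(P)(x) = (x̄/|x|³)·P(x̄/|x|²) -/
def kelvin (P : R3 → QH) (x : R3) : QH :=
  ((‖x‖ ^ 3)⁻¹ • toQbar x) * P ((‖x‖ ^ 2)⁻¹ • barPt x)

/-- the outer Appell function A_{-(n+2)}^l -/
def outerAppell (n l : ℕ) (x : R3) : QH :=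
  (((n + l + 1).factorial * (n - l).factorial : ℝ) / (n.factorial * (n + 1).factorial)) •
    kelvin (appell n l) x

/-- surface integral over the sphere of radius ρ (parametrized by the unit sphere
with its surface measure, with the Jacobian factor ρ²) -/
def sphereIntegral (ρ : ℝ) (g : R3 → QH) : QH :=
  ∫ ω : sphere (0 : R3) 1, (ρ ^ 2) • g (ρ • (ω : R3)) ∂((volume : Measure R3).toSphere)

/-- the unified family ψ_k^l, k ∈ ℤ \ {-1}: inner Appell polynomials for k ≥ 0,
outer Appell functions for k ≤ -2 -/
def psiFam (k : ℤ) (l : ℕ) (x : R3) : QH :=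
  if 0 ≤ k then appell k.toNat l x else outerAppell (-k - 2).toNat l x

/-- the coefficient of `x̄^h x^(m-h) ζ^l` in `A_{l+m}^l`, up to normalization -/
def appellCoeff (l m h : ℕ) : ℝ :=
  ((2 * (l + m) - 2 * h + 1).factorial * (2 * l + 2 * h).factorial : ℝ) /
    (h.factorial * (m - h).factorial * (l + m - h).factorial * (l + h).factorial)

/-- the normalizing factor of `A_{l+m}^l` -/
def appellScale (l m : ℕ) : ℝ :=
  ((l + m).factorial * l.factorial : ℝ) /
    (2 ^ (2 * m) * (l + m + l + 1).factorial * (2 * l).factorial)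

theorem appell_add (l m : ℕ) (x : R3) :
    appell (l + m) l x = appellScale l m •
      ((∑ h ∈ Finset.range (m + 1), appellCoeff l m h • (toQbar x ^ h * toQ x ^ (m - h))) *
        zeta x ^ l) := by
  simp only [appell, appellScale, appellCoeff, Nat.add_sub_cancel_left]

theorem appellScale_succ (l m : ℕ) :
    appellScale l (m + 1) =
      appellScale l m * (((l + m : ℕ) + 1 : ℝ) / (4 * ((l + m : ℕ) + l + 2))) := by
  have h₁ : l + (m + 1) + l + 1 = (l + m + l + 1) + 1 := by ring
  simp only [appellScale]
  rw [h₁, ← add_assoc l m 1, Nat.factorial_succ (l + m), Nat.factorial_succ (l + m + l + 1),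
    mul_add 2 m 1, pow_add]
  push_cast
  field_simp
  ring

theorem appellCoeff_succ_left (l m k : ℕ) (hk : k ≤ m) :
    appellCoeff l (m + 1) k * ((m : ℝ) + 1 - k) =
      2 * (2 * ((l : ℝ) + m) + 3 - 2 * k) * appellCoeff l m k := by
  obtain ⟨j, rfl⟩ := Nat.exists_eq_add_of_le hk
  have h₁ : 2 * (l + (k + j + 1)) - 2 * k + 1 = 2 * (l + j) + 1 + 1 + 1 := by omega
  have h₂ : 2 * (l + (k + j)) - 2 * k + 1 = 2 * (l + j) + 1 := by omega
  have h₃ : k + j + 1 - k = j + 1 := by omega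
  have h₄ : k + j - k = j := by omega
  have h₅ : l + (k + j + 1) - k = l + j + 1 := by omega
  have h₆ : l + (k + j) - k = l + j := by omega
  simp only [appellCoeff, h₁, h₂, h₃, h₄, h₅, h₆]
  rw [Nat.factorial_succ (2 * (l + j) + 1 + 1), Nat.factorial_succ (2 * (l + j) + 1),
    Nat.factorial_succ j, Nat.factorial_succ (l + j)]
  push_cast
  field_simp
  ring

theorem appellCoeff_succ_right (l m k : ℕ) (hk : k ≤ m) :
    appellCoeff l (m + 1) (k + 1) * ((k : ℝ) + 1) =
      2 * (2 * ((l : ℝ) + m) + 1 - 2 * k) * appellCoeff l m (m - k) := by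
  obtain ⟨j, rfl⟩ := Nat.exists_eq_add_of_le hk
  have h₁ : 2 * (l + (k + j + 1)) - 2 * (k + 1) + 1 = 2 * (l + j) + 1 := by omega
  have h₂ : 2 * (l + (k + j)) - 2 * j + 1 = 2 * (l + k) + 1 := by omega
  have h₃ : k + j + 1 - (k + 1) = j := by omega
  have h₄ : k + j - k = j := by omega
  have h₅ : l + (k + j + 1) - (k + 1) = l + j := by omega
  have h₆ : l + (k + j) - j = l + k := by omega
  have h₇ : 2 * l + 2 * (k + 1) = 2 * (l + k) + 1 + 1 := by ring
  have h₈ : k + j - j = k := by omega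
  simp only [appellCoeff, h₄]
  simp only [h₁, h₂, h₃, h₅, h₆, h₇, h₈, ← add_assoc l k 1, ← mul_add 2 l j]
  rw [Nat.factorial_succ (2 * (l + k) + 1), Nat.factorial_succ k, Nat.factorial_succ (l + k),
    Nat.factorial_succ (2 * (l + j))]
  push_cast
  field_simp
  ring

theorem invol_re (a : QH) : (invol a).re = a.re := rfl

theorem invol_imI (a : QH) : (invol a).imI = -a.imI := rfl

theorem invol_imJ (a : QH) : (invol a).imJ = -a.imJ := rfl

theorem invol_imK (a : QH) : (invol a).imK = a.imK := rfl

theorem invol_mul (a b : QH) : invol (a * b) = invol a * invol b := by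
  ext <;> simp only [invol_re, invol_imI, invol_imJ, invol_imK, Quaternion.re_mul,
    Quaternion.imI_mul, Quaternion.imJ_mul, Quaternion.imK_mul] <;> ring

theorem invol_add (a b : QH) : invol (a + b) = invol a + invol b := by
  ext <;> simp only [invol_re, invol_imI, invol_imJ, invol_imK, Quaternion.re_add,
    Quaternion.imI_add, Quaternion.imJ_add, Quaternion.imK_add] <;> ring

theorem invol_coe (r : ℝ) : invol (r : QH) = r := by
  ext <;> simp only [invol_re, invol_imI, invol_imJ, invol_imK, Quaternion.re_coe,
    Quaternion.imI_coe, Quaternion.imJ_coe, Quaternion.imK_coe, neg_zero]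

/-- `invol` is an algebra endomorphism of the quaternions. -/
def involHom : QH →ₐ[ℝ] QH where
  toFun := invol
  map_one' := invol_coe 1
  map_mul' := invol_mul
  map_zero' := invol_coe 0
  map_add' := invol_add
  commutes' := invol_coe

theorem involHom_toQ (x : R3) : involHom (toQ x) = toQbar x := by
  change invol _ = _
  ext <;> simp [invol, toQ, toQbar]

theorem involHom_toQbar (x : R3) : involHom (toQbar x) = toQ x := by
  change invol _ = _
  ext <;> simp [invol, toQ, toQbar]

theorem involHom_zeta (x : R3) : involHom (zeta x) = zeta x := by
  change invol _ = _
  ext <;> simp [invol, zeta]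

theorem commute_toQ_toQbar (x : R3) : Commute (toQ x) (toQbar x) := by
  have h : toQbar x = star (toQ x) := by
    ext <;> simp only [Quaternion.re_star, Quaternion.imI_star, Quaternion.imJ_star,
      Quaternion.imK_star] <;> simp [toQ, toQbar]
  rw [h, commute_iff_eq, Quaternion.self_mul_star, Quaternion.star_mul_self]

theorem invol_appell_add (l m : ℕ) (x : R3) :
    invol (appell (l + m) l x) = appellScale l m •
      ((∑ h ∈ Finset.range (m + 1), appellCoeff l m (m - h) •
        (toQbar x ^ h * toQ x ^ (m - h))) * zeta x ^ l) := by
  change involHom _ = _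
  rw [appell_add, map_smul, map_mul, map_pow, involHom_zeta, map_sum, ← Finset.sum_range_reflect]
  congr 2
  refine Finset.sum_congr rfl fun h hh => ?_
  have hh' : h ≤ m := Nat.lt_succ_iff.mp (Finset.mem_range.mp hh)
  rw [map_smul, map_mul, map_pow, map_pow, involHom_toQ, involHom_toQbar,
    show m + 1 - 1 - h = m - h by omega, Nat.sub_sub_self hh',
    ((commute_toQ_toQbar x).pow_pow _ _).eq]

/-- The recurrence for the homogeneous sums underlying the Appell polynomials. -/
theorem sum_appellCoeff_succ {A : Type*} [Ring A] [Algebra ℝ A] {p q : A} (hpq : Commute p q)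
    (l m : ℕ) :
    (((m : ℝ) + 1) / 2) •
        ∑ k ∈ Finset.range (m + 2), appellCoeff l (m + 1) k • (q ^ k * p ^ (m + 1 - k)) =
      (2 * ((l : ℝ) + m) + 3) •
          (p * ∑ k ∈ Finset.range (m + 1), appellCoeff l m k • (q ^ k * p ^ (m - k))) +
        (2 * (l : ℝ) + 1) •
          (q * ∑ k ∈ Finset.range (m + 1), appellCoeff l m (m - k) • (q ^ k * p ^ (m - k))) := by
  have hpos : ∀ k ≤ m + 1, 0 < 2 * ((l : ℝ) + m) + 3 - 2 * k := fun k hk => by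
    have : (k : ℝ) ≤ m + 1 := by exact_mod_cast hk
    have : (0 : ℝ) ≤ l := l.cast_nonneg
    linarith
  let w : ℕ → ℝ := fun k => appellCoeff l (m + 1) k / (2 * (2 * ((l : ℝ) + m) + 3 - 2 * k))
  have split : ∀ k ∈ Finset.range (m + 2),
      (((m : ℝ) + 1) / 2) • appellCoeff l (m + 1) k • (q ^ k * p ^ (m + 1 - k)) =
        ((2 * ((l : ℝ) + m) + 3) * (w k * (m + 1 - k))) • (q ^ k * p ^ (m + 1 - k)) +
          ((2 * (l : ℝ) + 1) * (w k * k)) • (q ^ k * p ^ (m + 1 - k)) := fun k hk => by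
    have := (hpos k (Nat.lt_succ_iff.mp (Finset.mem_range.mp hk))).ne'
    rw [smul_smul, ← add_smul]
    congr 1
    simp only [w]
    field_simp
    ring
  rw [Finset.smul_sum, Finset.sum_congr rfl split, Finset.sum_add_distrib,
    Finset.sum_range_succ _ (m + 1), Finset.sum_range_succ' _ (m + 1)]
  simp only [Finset.mul_sum, Finset.smul_sum]
  have htop : ((m : ℝ) + 1 - (m + 1 : ℕ)) = 0 := by push_cast; ring
  rw [htop]
  simp only [mul_zero, zero_smul, add_zero, Nat.cast_zero]
  congr 1
  · refine Finset.sum_congr rfl fun k hk => ?_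
    have hk' : k ≤ m := Nat.lt_succ_iff.mp (Finset.mem_range.mp hk)
    have := (hpos k (by omega)).ne'
    rw [mul_smul_comm, smul_smul, ← mul_assoc p, (hpq.pow_right k).eq, mul_assoc, ← pow_succ',
      ← Nat.sub_add_comm hk']
    congr 2
    simp only [w]
    rw [div_mul_eq_mul_div, appellCoeff_succ_left l m k hk']
    field_simp
  · refine Finset.sum_congr rfl fun k hk => ?_
    have hk' : k ≤ m := Nat.lt_succ_iff.mp (Finset.mem_range.mp hk)
    have := (hpos (k + 1) (by omega)).ne'
    rw [mul_smul_comm, smul_smul, ← mul_assoc q, ← pow_succ', Nat.add_sub_add_right]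
    congr 2
    simp only [w]
    push_cast at this ⊢
    rw [div_mul_eq_mul_div, appellCoeff_succ_right l m k hk', div_eq_iff (by simpa using this)]
    ring

/-- the recurrence
A_{n+1}^l = ((n+1)/(2(n-l+1)(n+l+2)))·[(2n+3)·x·A_n^l + (2l+1)·x̄·(A_n^l)^]. -/
theorem appell_recurrence_II (n l : ℕ) (hl : l ≤ n) (x : R3) :
    appell (n + 1) l x =
      (((n : ℝ) + 1) / (2 * ((n : ℝ) - l + 1) * ((n : ℝ) + l + 2))) •
        ((2 * (n : ℝ) + 3) • (toQ x * appell n l x)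
          + (2 * (l : ℝ) + 1) • (toQbar x * invol (appell n l x))) := by
  obtain ⟨m, rfl⟩ := Nat.exists_eq_add_of_le hl
  rw [invol_appell_add, add_assoc l m 1, appell_add, appell_add, appellScale_succ]
  simp only [mul_smul_comm, ← mul_assoc]
  rw [smul_comm _ (appellScale l m), smul_comm _ (appellScale l m), ← smul_add, smul_smul,
    ← smul_mul_assoc (2 * ((l + m : ℕ) : ℝ) + 3), ← smul_mul_assoc (2 * (l : ℝ) + 1), ← add_mul]
  push_cast
  rw [← sum_appellCoeff_succ (commute_toQ_toQbar x), smul_mul_assoc, smul_smul]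
  congr 1
  have h₁ : ((l : ℝ) + m - l + 1) = m + 1 := by ring
  have h₂ : ((m : ℝ) + 1) ≠ 0 := by positivity
  have h₃ : ((l : ℝ) + m + l + 2) ≠ 0 := by positivity
  rw [h₁]
  field_simp
  norm_num
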